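/- Interpolated collapsing estimate: for every 0 < ε < 1/2 and every 0 < ε' < 1/2 − ε, set α := ((1/2+ε)/(1/2−ε))·ε' and q := (1−2ε)/(1/2−ε'−ε) (so q ≥ 2). Then there is a constant C = C(ε,ε') such that for every Schwartz Γ₀ on ℝ², the solution Γ(t) = e^{it(Δ_x−Δ_y)}Γ₀ satisfies ‖ |∇_x|^{1/2−ε'} ρ_Γ ‖_{L^q(ℝ_t; L²(ℝ_x))} ≤ C ‖ |∇_{x,y}|^{α} Γ₀ ‖_{L²(ℝ²)}. -/

import Mathlib

open MeasureTheory Complex SchwartzMap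
open scoped ENNReal NNReal Real

noncomputable section

/-- 1D Fourier transform with the convention `f̂ ξ = ∫ e^{-iξx} f x dx`. -/
def FT1 (f : ℝ → ℂ) (ξ : ℝ) : ℂ :=
  ∫ x : ℝ, Complex.exp (-(Complex.I) * (ξ : ℂ) * (x : ℂ)) * f x

/-- 1D inverse Fourier transform. -/
def IFT1 (g : ℝ → ℂ) (x : ℝ) : ℂ :=
  (2 * (Real.pi : ℂ))⁻¹ * ∫ ξ : ℝ, Complex.exp (Complex.I * (ξ : ℂ) * (x : ℂ)) * g ξ

/-- 2D Fourier transform (curried kernels). -/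
def FT2 (f : ℝ → ℝ → ℂ) (ξ η : ℝ) : ℂ :=
  ∫ x : ℝ, ∫ y : ℝ, Complex.exp (-(Complex.I) * ((ξ : ℂ) * x + (η : ℂ) * y)) * f x y

/-- 2D inverse Fourier transform. -/
def IFT2 (g : ℝ → ℝ → ℂ) (x y : ℝ) : ℂ :=
  ((2 * (Real.pi : ℂ)) ^ 2)⁻¹ *
    ∫ ξ : ℝ, ∫ η : ℝ, Complex.exp (Complex.I * ((ξ : ℂ) * x + (η : ℂ) * y)) * g ξ η

/-- Free propagator `e^{it(Δ_x − Δ_y)}`, Fourier multiplier `e^{it(η²−ξ²)}`. -/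
def freeGamma (Γ₀ : ℝ → ℝ → ℂ) (t x y : ℝ) : ℂ :=
  IFT2 (fun ξ η => Complex.exp (Complex.I * (t : ℂ) * ((η : ℂ) ^ 2 - (ξ : ℂ) ^ 2)) * FT2 Γ₀ ξ η) x y

/-- Free propagator `e^{it(Δ_x + Δ_y)}`, Fourier multiplier `e^{−it(ξ²+η²)}`. -/
def freeLambda (Λ₀ : ℝ → ℝ → ℂ) (t x y : ℝ) : ℂ :=
  IFT2 (fun ξ η => Complex.exp (-(Complex.I) * (t : ℂ) * ((ξ : ℂ) ^ 2 + (η : ℂ) ^ 2)) * FT2 Λ₀ ξ η) x y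

/-- `|∇_x|^s`, Fourier multiplier `|ξ|^s` in one variable. -/
def absDx (s : ℝ) (f : ℝ → ℂ) (x : ℝ) : ℂ :=
  IFT1 (fun ξ => ((|ξ| ^ s : ℝ) : ℂ) * FT1 f ξ) x

/-- `|∇_{x,y}|^s`, Fourier multiplier `(ξ²+η²)^{s/2}` on `ℝ²`. -/
def absDxy (s : ℝ) (f : ℝ → ℝ → ℂ) (x y : ℝ) : ℂ :=
  IFT2 (fun ξ η => (((ξ ^ 2 + η ^ 2) ^ (s / 2) : ℝ) : ℂ) * FT2 f ξ η) x y

/-- `|∇_{x+y}|^s`, Fourier multiplier `(|ξ+η|/2)^s` on `ℝ²`. -/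
def absDxpy (s : ℝ) (f : ℝ → ℝ → ℂ) (x y : ℝ) : ℂ :=
  IFT2 (fun ξ η => (((|ξ + η| / 2) ^ s : ℝ) : ℂ) * FT2 f ξ η) x y

/-- `⟨∇_x⟩^s`, Fourier multiplier `(1+ξ²)^{s/2}` in one variable. -/
def japDx (s : ℝ) (f : ℝ → ℂ) (x : ℝ) : ℂ :=
  IFT1 (fun ξ => (((1 + ξ ^ 2) ^ (s / 2) : ℝ) : ℂ) * FT1 f ξ) x

/-- `⟨∇_{x,y}⟩^s`, Fourier multiplier `(1+ξ²+η²)^{s/2}` on `ℝ²`. -/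
def japDxy (s : ℝ) (f : ℝ → ℝ → ℂ) (x y : ℝ) : ℂ :=
  IFT2 (fun ξ η => (((1 + ξ ^ 2 + η ^ 2) ^ (s / 2) : ℝ) : ℂ) * FT2 f ξ η) x y

/-- `L²` norm of a kernel on `ℝ²`. -/
def L2K (f : ℝ → ℝ → ℂ) : ℝ≥0∞ :=
  eLpNorm (fun p : ℝ × ℝ => f p.1 p.2) 2 volume

/-- `L²` norm on `ℝ`. -/
def L2F (f : ℝ → ℂ) : ℝ≥0∞ := eLpNorm f 2 volume

/-- Mixed norm `L^q(μ(dt)) L^r(dx)` for a function of `(t,x)`. -/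
def MixedN2 (μ : Measure ℝ) (q r : ℝ≥0∞) (u : ℝ → ℝ → ℂ) : ℝ≥0∞ :=
  eLpNorm (fun t => (eLpNorm (u t) r volume).toReal) q μ

/-- Mixed norm `L^q(μ(dt)) L^r(dx) L^s(dy)` for a function of `(t,x,y)`. -/
def MixedN3 (μ : Measure ℝ) (q r s : ℝ≥0∞) (u : ℝ → ℝ → ℝ → ℂ) : ℝ≥0∞ :=
  eLpNorm (fun t => (eLpNorm (fun x => (eLpNorm (u t x) s volume).toReal) r volume).toReal) q μ

/-- Spacetime Fourier transform on `ℝ_t × ℝ_x`. -/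
def FTtx (u : ℝ → ℝ → ℂ) (τ ξ : ℝ) : ℂ :=
  ∫ t : ℝ, ∫ x : ℝ, Complex.exp (-(Complex.I) * ((τ : ℂ) * t + (ξ : ℂ) * x)) * u t x

/-- Spacetime Fourier transform on `ℝ_t × ℝ²`. -/
def FTtxy (u : ℝ → ℝ → ℝ → ℂ) (τ ξ η : ℝ) : ℂ :=
  ∫ t : ℝ, ∫ x : ℝ, ∫ y : ℝ,
    Complex.exp (-(Complex.I) * ((τ : ℂ) * t + (ξ : ℂ) * x + (η : ℂ) * y)) * u t x y

/-- Bourgain space norm `X^b` associated to `𝐒 = (1/i)∂_t − Δ_x − Δ_y`. -/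
def XbNorm (b : ℝ) (u : ℝ → ℝ → ℝ → ℂ) : ℝ≥0∞ :=
  eLpNorm (fun p : ℝ × ℝ × ℝ =>
    (((1 + |p.1 + p.2.1 ^ 2 + p.2.2 ^ 2|) ^ b : ℝ) : ℂ) * FTtxy u p.1 p.2.1 p.2.2) 2 volume

/-- Duhamel solution of `𝐒_± Γ = F` with data `Γ₀`. -/
def duhamelGamma (Γ₀ : ℝ → ℝ → ℂ) (F : ℝ → ℝ → ℝ → ℂ) (t x y : ℝ) : ℂ :=
  freeGamma Γ₀ t x y + Complex.I * ∫ s in (0:ℝ)..t, freeGamma (F s) (t - s) x y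

/-- Duhamel solution of `𝐒 Λ = F` with data `Λ₀`. -/
def duhamelLambda (Λ₀ : ℝ → ℝ → ℂ) (F : ℝ → ℝ → ℝ → ℂ) (t x y : ℝ) : ℂ :=
  freeLambda Λ₀ t x y + Complex.I * ∫ s in (0:ℝ)..t, freeLambda (F s) (t - s) x y


section Plancherel

open FourierTransform

/-- The integral Fourier transform of a function in `L¹ ∩ L²` represents its `L²` Fourier
transform. -/
theorem fourier_toLp_ae_eq {f : ℝ → ℂ} (hf : Integrable f) (hf2 : MemLp f 2) :
    (𝓕 (hf2.toLp f) : Lp (α := ℝ) ℂ 2) =ᵐ[volume] 𝓕 f := by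
  have hcont : Continuous (𝓕 f) :=
    VectorFourier.fourierIntegral_continuous Real.continuous_fourierChar
      (by exact continuous_inner) hf
  refine ae_eq_of_integral_contDiff_smul_eq
    ((Lp.memLp _).locallyIntegrable (by norm_num)) hcont.locallyIntegrable ?_
  intro g hg hgs
  have hgs' : HasCompactSupport (fun x => (g x : ℂ)) :=
    hgs.comp_left (g := fun x : ℝ => (x : ℂ)) (by simp)
  let φ : 𝓢(ℝ, ℂ) := hgs'.toSchwartzMap (Complex.ofRealCLM.contDiff.comp hg)
  have hφ : ∀ x, φ x = (g x : ℂ) := fun x => rfl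
  have h1 := congrArg (fun T => T φ) (Lp.fourier_toTemperedDistribution_eq (hf2.toLp f))
  simp only [TemperedDistribution.fourier_apply, Lp.toTemperedDistribution_apply] at h1
  have h2 : ∫ x, (𝓕 φ) x • (hf2.toLp f : ℝ → ℂ) x = ∫ x, (𝓕 φ) x • f x := by
    refine integral_congr_ae ?_
    filter_upwards [hf2.coeFn_toLp] with x hx
    rw [hx]
  have h3 : ∫ x, (𝓕 φ) x • f x = ∫ x, φ x • (𝓕 f) x := by
    rw [SchwartzMap.fourier_coe]
    have := VectorFourier.integral_fourierIntegral_smul_eq_flip (L := innerₗ ℝ)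
      (μ := volume) (ν := volume) Real.continuous_fourierChar (by exact continuous_inner)
      φ.integrable hf
    rw [flip_innerₗ] at this
    exact this
  rw [h2, h3] at h1
  simp only [hφ] at h1
  simpa [Complex.real_smul] using h1.symm

theorem eLpNorm_fourier_two {f : ℝ → ℂ} (hf : Integrable f) (hf2 : MemLp f 2) :
    eLpNorm (𝓕 f) 2 volume = eLpNorm f 2 volume := by
  rw [← eLpNorm_congr_ae (fourier_toLp_ae_eq hf hf2), ← eLpNorm_congr_ae hf2.coeFn_toLp]
  have := Lp.norm_fourier_eq (hf2.toLp f)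
  rw [Lp.norm_def, Lp.norm_def] at this
  exact (ENNReal.toReal_eq_toReal_iff' (Lp.eLpNorm_ne_top _) (Lp.eLpNorm_ne_top _)).1 this

theorem FT1_eq_fourier (f : ℝ → ℂ) (ξ : ℝ) : FT1 f ξ = 𝓕 f (ξ / (2 * π)) := by
  rw [Real.fourier_real_eq_integral_exp_smul, FT1]
  refine integral_congr_ae (Filter.Eventually.of_forall fun x => ?_)
  simp only [smul_eq_mul]
  congr 2
  push_cast
  field_simp

theorem IFT1_eq_FT1 (g : ℝ → ℂ) (x : ℝ) : IFT1 g x = (2 * (π : ℂ))⁻¹ * FT1 g (-x) := by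
  rw [IFT1, FT1]
  congr 2
  ext ξ
  congr 2
  push_cast
  ring

theorem IFT1_eq_fourierInv (g : ℝ → ℂ) (x : ℝ) :
    IFT1 g x = (2 * (π : ℂ))⁻¹ * 𝓕⁻ g (x / (2 * π)) := by
  rw [IFT1_eq_FT1, FT1_eq_fourier, Real.fourierInv_eq_fourier_neg, neg_div]

theorem lintegral_comp_mul_right_real (f : ℝ → ℝ≥0∞) {a : ℝ} (ha : a ≠ 0) :
    ∫⁻ x, f (x * a) = ENNReal.ofReal |a|⁻¹ * ∫⁻ x, f x := by
  have h := (Homeomorph.mulRight₀ a ha).measurableEmbedding.lintegral_map (μ := volume) f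
  have hm : Measure.map (Homeomorph.mulRight₀ a ha) volume =
      ENNReal.ofReal |a⁻¹| • (volume : Measure ℝ) := Real.map_volume_mul_right ha
  rw [hm, lintegral_smul_measure, abs_inv] at h
  simpa using h.symm

theorem lintegral_enorm_sq_fourier {f : ℝ → ℂ} (hf : Integrable f) (hf2 : MemLp f 2) :
    ∫⁻ x, ‖𝓕 f x‖ₑ ^ 2 = ∫⁻ x, ‖f x‖ₑ ^ 2 := by
  have h := congrArg (· ^ 2) (eLpNorm_fourier_two hf hf2)
  have e : ∀ g : ℝ → ℂ, eLpNorm g 2 volume ^ 2 = ∫⁻ x, ‖g x‖ₑ ^ 2 := fun g => by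
    simpa using eLpNorm_nnreal_pow_eq_lintegral (f := g) (p := 2) (μ := volume) (by simp)
  simpa only [e] using h

/-- Plancherel's theorem for the unnormalised transform on `L¹ ∩ L²`. -/
theorem lintegral_enorm_sq_FT1 {f : ℝ → ℂ} (hf : Integrable f) (hf2 : MemLp f 2) :
    ∫⁻ x, ‖FT1 f x‖ₑ ^ 2 = ENNReal.ofReal (2 * π) * ∫⁻ x, ‖f x‖ₑ ^ 2 := by
  have h := lintegral_comp_mul_right_real (fun x => ‖𝓕 f x‖ₑ ^ 2)
    (a := (2 * π)⁻¹) (by positivity)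
  simp only [FT1_eq_fourier, div_eq_mul_inv]
  rw [h, lintegral_enorm_sq_fourier hf hf2, abs_of_pos (by positivity), inv_inv]

theorem FT1_eq_zero_of_not_integrable {f : ℝ → ℂ} (hf : ¬ Integrable f) (x : ℝ) :
    FT1 f x = 0 := by
  refine integral_undef fun h => hf ?_
  refine (h.bdd_mul (c := 1) (f := fun y : ℝ => Complex.exp (Complex.I * x * y))
    (by fun_prop) (Filter.Eventually.of_forall fun y => ?_)).congr
    (Filter.Eventually.of_forall fun y => ?_)
  · rw [show Complex.I * x * y = ((x * y : ℝ) : ℂ) * Complex.I by push_cast; ring,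
      Complex.norm_exp_ofReal_mul_I]
  · simp only [← mul_assoc, ← Complex.exp_add]
    simp

theorem lintegral_enorm_sq_FT1_le (f : ℝ → ℂ) :
    ∫⁻ x, ‖FT1 f x‖ₑ ^ 2 ≤ ENNReal.ofReal (2 * π) * ∫⁻ x, ‖f x‖ₑ ^ 2 := by
  by_cases hf : Integrable f
  · by_cases hf2 : MemLp f 2
    · exact (lintegral_enorm_sq_FT1 hf hf2).le
    · have : ∫⁻ x, ‖f x‖ₑ ^ 2 = ∞ := by
        by_contra hne
        refine hf2 ⟨hf.1, ?_⟩
        rw [eLpNorm_lt_top_iff_lintegral_rpow_enorm_lt_top (by norm_num) (by norm_num)]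
        simpa [lt_top_iff_ne_top] using hne
      rw [this, ENNReal.mul_top (by simp [Real.pi_pos])]
      exact le_top
  · simp [FT1_eq_zero_of_not_integrable hf]

theorem lintegral_enorm_sq_comp_neg (f : ℝ → ℂ) : ∫⁻ x, ‖f (-x)‖ₑ ^ 2 = ∫⁻ x, ‖f x‖ₑ ^ 2 :=
  lintegral_neg_eq_self (fun x => ‖f x‖ₑ ^ 2)

theorem lintegral_enorm_sq_IFT1_eq_mul (g : ℝ → ℂ) :
    ∫⁻ x, ‖IFT1 g x‖ₑ ^ 2 = ENNReal.ofReal ((2 * π)⁻¹ ^ 2) * ∫⁻ x, ‖FT1 g x‖ₑ ^ 2 := by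
  rw [← lintegral_enorm_sq_comp_neg (FT1 g), ← lintegral_const_mul']
  · refine lintegral_congr fun x => ?_
    rw [IFT1_eq_FT1, enorm_mul, mul_pow]
    congr 1
    rw [ENNReal.ofReal_pow (by positivity), ← ofReal_norm]
    congr 2
    simp [abs_of_pos Real.pi_pos]
  · exact ENNReal.ofReal_ne_top

theorem lintegral_enorm_sq_IFT1 {g : ℝ → ℂ} (hf : Integrable g) (hf2 : MemLp g 2) :
    ∫⁻ x, ‖IFT1 g x‖ₑ ^ 2 = ENNReal.ofReal (2 * π)⁻¹ * ∫⁻ x, ‖g x‖ₑ ^ 2 := by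
  rw [lintegral_enorm_sq_IFT1_eq_mul, lintegral_enorm_sq_FT1 hf hf2, ← mul_assoc,
    ← ENNReal.ofReal_mul (by positivity)]
  congr 2
  field_simp

theorem lintegral_enorm_sq_IFT1_le (g : ℝ → ℂ) :
    ∫⁻ x, ‖IFT1 g x‖ₑ ^ 2 ≤ ENNReal.ofReal (2 * π)⁻¹ * ∫⁻ x, ‖g x‖ₑ ^ 2 := by
  rw [lintegral_enorm_sq_IFT1_eq_mul]
  refine (mul_le_mul_right (lintegral_enorm_sq_FT1_le g) _).trans_eq ?_
  rw [← mul_assoc, ← ENNReal.ofReal_mul (by positivity)]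
  congr 2
  field_simp

end Plancherel

section Sobolev

theorem continuous_FT1 {G : ℝ → ℂ} (hG : Integrable G) : Continuous (FT1 G) := by
  refine continuous_of_dominated (bound := fun x => ‖G x‖) (fun s => ?_) (fun s => ?_) hG.norm ?_
  · exact (by fun_prop : Continuous fun x : ℝ =>
      Complex.exp (-(Complex.I) * (s : ℂ) * x)).aestronglyMeasurable.mul hG.1
  · refine Filter.Eventually.of_forall fun x => ?_
    rw [norm_mul, show -Complex.I * s * x = ((-(s * x) : ℝ) : ℂ) * Complex.I by push_cast; ring,
      Complex.norm_exp_ofReal_mul_I, one_mul]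
  · exact Filter.Eventually.of_forall fun x => by fun_prop

theorem enorm_FT1_le (G : ℝ → ℂ) (s : ℝ) : ‖FT1 G s‖ₑ ≤ ∫⁻ x, ‖G x‖ₑ := by
  refine (enorm_integral_le_lintegral_enorm _).trans_eq (lintegral_congr fun x => ?_)
  rw [enorm_mul, show -Complex.I * s * x = ((-(s * x) : ℝ) : ℂ) * Complex.I by push_cast; ring,
    ← ofReal_norm, Complex.norm_exp_ofReal_mul_I, ENNReal.ofReal_one, one_mul]

theorem integrable_exp_mul {G : ℝ → ℂ} (hG : Integrable G) (s : ℝ) :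
    Integrable fun x : ℝ => Complex.exp (-(Complex.I) * (s : ℂ) * x) * G x := by
  refine hG.bdd_mul (c := 1) (by fun_prop) (Filter.Eventually.of_forall fun x => ?_)
  rw [show -Complex.I * s * x = ((-(s * x) : ℝ) : ℂ) * Complex.I by push_cast; ring,
      Complex.norm_exp_ofReal_mul_I]

theorem FT1_add {f g : ℝ → ℂ} (hf : Integrable f) (hg : Integrable g) (s : ℝ) :
    FT1 (f + g) s = FT1 f s + FT1 g s := by
  simp only [FT1, Pi.add_apply, mul_add]
  exact integral_add (integrable_exp_mul hf s) (integrable_exp_mul hg s)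

theorem lintegral_Ioc_rpow {r A : ℝ} (hr : -1 < r) (hA : 0 ≤ A) :
    ∫⁻ x in Set.Ioc 0 A, ENNReal.ofReal (x ^ r) = ENNReal.ofReal (A ^ (r + 1) / (r + 1)) := by
  have hi := intervalIntegral.intervalIntegrable_rpow' (a := 0) (b := A) hr
  rw [← ofReal_integral_eq_lintegral_ofReal, ← intervalIntegral.integral_of_le hA,
    integral_rpow (Or.inl hr), Real.zero_rpow (by linarith), sub_zero]
  · exact (intervalIntegrable_iff_integrableOn_Ioc_of_le hA).1 hi
  · filter_upwards [ae_restrict_mem measurableSet_Ioc] with x hx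
    exact Real.rpow_nonneg hx.1.le _

theorem lintegral_abs_lt_rpow_le {r A : ℝ} (hr : -1 < r) (hA : 0 ≤ A) :
    ∫⁻ x in {x : ℝ | |x| < A}, ENNReal.ofReal (|x| ^ r)
      ≤ ENNReal.ofReal (2 * (A ^ (r + 1) / (r + 1))) := by
  have hsub : {x : ℝ | |x| < A} ⊆ (Set.Ioc 0 A ∪ Neg.neg ⁻¹' Set.Ioc 0 A) ∪ {0} := by
    intro x hx
    simp only [Set.mem_ofPred_eq, abs_lt] at hx
    rcases lt_trichotomy x 0 with h | h | h
    · exact Or.inl (Or.inr ⟨by linarith, by linarith⟩)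
    · exact Or.inr h
    · exact Or.inl (Or.inl ⟨h, hx.2.le⟩)
  have hpos : ∫⁻ x in Set.Ioc 0 A, ENNReal.ofReal (|x| ^ r)
      = ENNReal.ofReal (A ^ (r + 1) / (r + 1)) := by
    rw [← lintegral_Ioc_rpow hr hA]
    refine setLIntegral_congr_fun measurableSet_Ioc fun x hx => ?_
    simp only [abs_of_pos hx.1]
  have hneg : ∫⁻ x in Neg.neg ⁻¹' Set.Ioc 0 A, ENNReal.ofReal (|x| ^ r)
      = ENNReal.ofReal (A ^ (r + 1) / (r + 1)) := by
    rw [← hpos]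
    have := (Measure.measurePreserving_neg (volume : Measure ℝ)).setLIntegral_comp_preimage_emb
      (Homeomorph.neg ℝ).measurableEmbedding (fun x => ENNReal.ofReal (|x| ^ r)) (Set.Ioc 0 A)
    simpa using this
  calc _ ≤ ∫⁻ x in (Set.Ioc 0 A ∪ Neg.neg ⁻¹' Set.Ioc 0 A) ∪ {0}, ENNReal.ofReal (|x| ^ r) :=
        lintegral_mono_set hsub
    _ ≤ _ := (lintegral_union_le _ _ _)
    _ ≤ (ENNReal.ofReal (A ^ (r + 1) / (r + 1)) + ENNReal.ofReal (A ^ (r + 1) / (r + 1))) + 0 := by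
        refine add_le_add ((lintegral_union_le _ _ _).trans_eq (by rw [hpos, hneg])) ?_
        simp
    _ = _ := by
        rw [add_zero, two_mul, ENNReal.ofReal_add] <;>
        exact div_nonneg (Real.rpow_nonneg hA _) (by linarith)

/-- Cauchy–Schwarz bound for the low frequencies. -/
theorem lintegral_abs_lt_enorm_le {b A : ℝ} (hb1 : b < 1) (hA : 0 ≤ A) {G : ℝ → ℂ}
    (hG : AEStronglyMeasurable G) :
    (∫⁻ ξ in {ξ : ℝ | |ξ| < A}, ‖G ξ‖ₑ)
      ≤ (∫⁻ ξ, ENNReal.ofReal (|ξ| ^ b) * ‖G ξ‖ₑ ^ 2) ^ (1 / 2 : ℝ)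
        * ENNReal.ofReal (2 * (A ^ (1 - b) / (1 - b))) ^ (1 / 2 : ℝ) := by
  set μ : Measure ℝ := volume.restrict {ξ : ℝ | |ξ| < A}
  set f : ℝ → ℝ≥0∞ := fun ξ => ENNReal.ofReal (|ξ| ^ (b / 2)) * ‖G ξ‖ₑ
  set g : ℝ → ℝ≥0∞ := fun ξ => ENNReal.ofReal (|ξ| ^ (-b / 2))
  have hfm : AEMeasurable f μ :=
    (((by fun_prop : Measurable fun ξ : ℝ =>
      ENNReal.ofReal (|ξ| ^ (b / 2)))).aemeasurable.mul hG.enorm).restrict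
  have hgm : AEMeasurable g μ :=
    ((by fun_prop : Measurable fun ξ : ℝ => ENNReal.ofReal (|ξ| ^ (-b / 2)))).aemeasurable
  have hne : ∀ᵐ ξ : ℝ ∂μ, ξ ≠ 0 := ae_restrict_of_ae (by simp [ae_iff])
  have hfg : ∫⁻ ξ, ‖G ξ‖ₑ ∂μ = ∫⁻ ξ, (f * g) ξ ∂μ := by
    refine lintegral_congr_ae ?_
    filter_upwards [hne] with ξ hξ
    have h0 : 0 < |ξ| := abs_pos.2 hξ
    simp only [f, g, Pi.mul_apply]
    rw [mul_right_comm, ← ENNReal.ofReal_mul (by positivity), ← Real.rpow_add h0,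
      show b / 2 + -b / 2 = 0 by ring, Real.rpow_zero, ENNReal.ofReal_one, one_mul]
  rw [hfg]
  refine (ENNReal.lintegral_mul_le_Lp_mul_Lq μ Real.HolderConjugate.two_two hfm hgm).trans ?_
  refine mul_le_mul' (ENNReal.rpow_le_rpow ?_ (by norm_num))
    (ENNReal.rpow_le_rpow ?_ (by norm_num))
  · refine (setLIntegral_le_lintegral _ _).trans_eq (lintegral_congr fun ξ => ?_)
    simp only [f]
    rw [ENNReal.mul_rpow_of_nonneg _ _ (by norm_num), ENNReal.ofReal_rpow_of_nonneg (by positivity)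
      (by norm_num), ← Real.rpow_mul (abs_nonneg _)]
    norm_num
  · have := lintegral_abs_lt_rpow_le (r := -b) (A := A) (by linarith) hA
    rw [show -b + 1 = 1 - b by ring] at this
    refine le_trans (le_of_eq (lintegral_congr fun ξ => ?_)) this
    simp only [g]
    rw [ENNReal.ofReal_rpow_of_nonneg (by positivity) (by norm_num), ← Real.rpow_mul (abs_nonneg _)]
    norm_num

/-- Level set estimate: Chebyshev for the high frequencies when the low ones are at most half
the level. -/
theorem volume_lt_norm_FT1_le {G : ℝ → ℂ} (hG : Integrable G) {S : Set ℝ} (hS : MeasurableSet S)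
    {l : ℝ} (hl : 0 < l) (hlow : ∫⁻ ξ in Sᶜ, ‖G ξ‖ₑ ≤ ENNReal.ofReal (l / 2)) :
    volume {s | l < ‖FT1 G s‖} ≤ ENNReal.ofReal (8 * π / l ^ 2) * ∫⁻ ξ in S, ‖G ξ‖ₑ ^ 2 := by
  have hSG : Integrable (S.indicator G) := hG.indicator hS
  have hScG : Integrable (Sᶜ.indicator G) := hG.indicator hS.compl
  have hsub : {s | l < ‖FT1 G s‖} ⊆
      {s | ENNReal.ofReal ((l / 2) ^ 2) ≤ ‖FT1 (S.indicator G) s‖ₑ ^ 2} := by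
    intro s hs
    simp only [Set.mem_ofPred_eq] at hs ⊢
    have h1 : FT1 G s = FT1 (S.indicator G) s + FT1 (Sᶜ.indicator G) s := by
      rw [← FT1_add hSG hScG, Set.indicator_self_add_compl]
    have h2 : ‖FT1 (Sᶜ.indicator G) s‖ ≤ l / 2 := by
      have := (enorm_FT1_le (Sᶜ.indicator G) s)
      simp only [enorm_indicator_eq_indicator_enorm] at this
      rw [lintegral_indicator hS.compl] at this
      have := this.trans hlow
      rw [← ofReal_norm] at this
      exact (ENNReal.ofReal_le_ofReal_iff (by linarith)).1 this
    have h3 : l / 2 ≤ ‖FT1 (S.indicator G) s‖ := by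
      have := norm_add_le (FT1 (S.indicator G) s) (FT1 (Sᶜ.indicator G) s)
      rw [← h1] at this
      linarith
    rw [← ofReal_norm, ← ENNReal.ofReal_pow (norm_nonneg _)]
    exact ENNReal.ofReal_le_ofReal (by gcongr)
  refine (measure_mono hsub).trans ?_
  have hm : AEMeasurable (fun s => ‖FT1 (S.indicator G) s‖ₑ ^ 2) :=
    ((continuous_FT1 hSG).measurable.enorm.pow_const 2).aemeasurable
  have hpl := lintegral_enorm_sq_FT1_le (S.indicator G)
  have hind : ∫⁻ x, ‖S.indicator G x‖ₑ ^ 2 = ∫⁻ ξ in S, ‖G ξ‖ₑ ^ 2 := by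
    rw [← lintegral_indicator hS]
    refine lintegral_congr fun x => ?_
    by_cases hx : x ∈ S <;> simp [hx]
  rw [hind] at hpl
  have hl2 : 0 < (l / 2) ^ 2 := by positivity
  refine (meas_ge_le_lintegral_div hm (by simpa using hl2.ne') ENNReal.ofReal_ne_top).trans ?_
  refine (ENNReal.div_le_div_right hpl _).trans_eq ?_
  rw [mul_comm, mul_div_assoc, ← ENNReal.ofReal_div_of_pos hl2, mul_comm]
  congr 2
  field_simp
  norm_num

/-- Homogeneous Sobolev embedding `Ḣ^{1/2 - 1/q}(ℝ) ⊂ L^q(ℝ)`, read on the Fourier side. -/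
theorem exists_lintegral_FT1_rpow_le {q : ℝ} (hq : 2 < q) :
    ∃ K : ℝ, 0 < K ∧ ∀ G : ℝ → ℂ, Integrable G →
      ∫⁻ s, ‖FT1 G s‖ₑ ^ q ≤ ENNReal.ofReal K *
        (∫⁻ ξ, ENNReal.ofReal (|ξ| ^ (1 - 2 / q)) * ‖G ξ‖ₑ ^ 2) ^ (q / 2) := by
  have hq0 : 0 < q := by linarith
  refine ⟨q * (8 * π * (2 * √q) ^ (q - 2) / (q - 2)), by
    have : 0 < q - 2 := by linarith
    positivity, fun G hG => ?_⟩
  set M := ∫⁻ ξ, ENNReal.ofReal (|ξ| ^ (1 - 2 / q)) * ‖G ξ‖ₑ ^ 2 with hM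
  have hK : 0 < q * (8 * π * (2 * √q) ^ (q - 2) / (q - 2)) := by
    have : 0 < q - 2 := by linarith
    positivity
  have hwm : AEMeasurable (fun ξ => ENNReal.ofReal (|ξ| ^ (1 - 2 / q)) * ‖G ξ‖ₑ ^ 2) :=
    (by fun_prop : Measurable fun ξ : ℝ => ENNReal.ofReal (|ξ| ^ (1 - 2 / q))).aemeasurable.mul
      (hG.1.enorm.pow_const 2)
  rcases eq_or_ne M ∞ with hMt | hMt
  · rw [hMt, ENNReal.top_rpow_of_pos (by positivity), ENNReal.mul_top (by simpa using hK)]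
    exact le_top
  rcases eq_or_ne M 0 with hM0 | hM0
  · have h0 : G =ᵐ[volume] 0 := by
      have hne : ∀ᵐ ξ : ℝ, ξ ≠ 0 := by simp [ae_iff]
      filter_upwards [(lintegral_eq_zero_iff' hwm).1 hM0, hne] with ξ h hξ
      have hp : 0 < |ξ| ^ (1 - 2 / q) := Real.rpow_pos_of_pos (abs_pos.2 hξ) _
      simpa [hp.not_ge] using h
    have hz : ∀ s, FT1 G s = 0 := fun s => by
      rw [FT1]
      refine integral_eq_zero_of_ae ?_
      filter_upwards [h0] with x hx
      simp [hx]
    simp [hz, hq0]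
  set m := M.toReal with hm
  have hmpos : 0 < m := ENNReal.toReal_pos hM0 hMt
  have hMm : M = ENNReal.ofReal m := (ENNReal.ofReal_toReal hMt).symm
  set D := 2 * √q * √m with hD
  have hDpos : 0 < D := by positivity
  set L : ℝ → ℝ := fun ξ => D * |ξ| ^ (1 / q) with hL
  have hLm : Measurable L := by fun_prop
  have hlevel : ∀ l : ℝ, 0 < l → volume {s | l < ‖FT1 G s‖}
      ≤ ENNReal.ofReal (8 * π / l ^ 2) * ∫⁻ ξ in {ξ | l ≤ L ξ}, ‖G ξ‖ₑ ^ 2 := by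
    intro l hl
    refine volume_lt_norm_FT1_le hG (measurableSet_le measurable_const hLm) hl ?_
    have hsub : {ξ | l ≤ L ξ}ᶜ ⊆ {ξ : ℝ | |ξ| < (l / D) ^ q} := by
      intro ξ hξ
      simp only [Set.mem_compl_iff, Set.mem_ofPred_eq, not_le, hL] at hξ ⊢
      have h1 : |ξ| ^ (1 / q) < l / D := by rw [lt_div_iff₀ hDpos]; linarith
      have h2 := Real.rpow_lt_rpow (by positivity) h1 hq0
      rwa [← Real.rpow_mul (abs_nonneg _), one_div_mul_cancel hq0.ne', Real.rpow_one] at h2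
    have hb : (1 - 2 / q) < 1 := by have : 0 < 2 / q := by positivity
                                    linarith
    refine (lintegral_mono_set hsub).trans
      ((lintegral_abs_lt_enorm_le hb (by positivity) hG.1).trans_eq ?_)
    rw [← hM, hMm, ENNReal.ofReal_rpow_of_nonneg hmpos.le (by norm_num),
      ENNReal.ofReal_rpow_of_nonneg (by rw [sub_sub_cancel]; positivity) (by norm_num),
      ← ENNReal.ofReal_mul (by positivity), ← Real.sqrt_eq_rpow, ← Real.sqrt_eq_rpow]
    congr 1
    rw [sub_sub_cancel, ← Real.rpow_mul (by positivity), mul_div_cancel₀ _ hq0.ne', Real.rpow_two,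
      show 2 * ((l / D) ^ 2 / (2 / q)) = q * (l / D) ^ 2 by field_simp, Real.sqrt_mul hq0.le,
      Real.sqrt_sq (by positivity), hD]
    field_simp
  have hcake := lintegral_rpow_eq_lintegral_meas_lt_mul (μ := volume) (f := fun s => ‖FT1 G s‖)
    (Filter.Eventually.of_forall fun s => norm_nonneg _)
    (continuous_FT1 hG).norm.measurable.aemeasurable hq0
  have hcake' : ∫⁻ s, ‖FT1 G s‖ₑ ^ q = ∫⁻ s, ENNReal.ofReal (‖FT1 G s‖ ^ q) :=
    lintegral_congr fun s => by
      rw [← ofReal_norm, ENNReal.ofReal_rpow_of_nonneg (norm_nonneg _) hq0.le]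
  rw [hcake', hcake]
  set F : ℝ → ℝ → ℝ≥0∞ := fun l ξ =>
    Set.indicator {p : ℝ × ℝ | p.1 ≤ L p.2}
      (fun p => ENNReal.ofReal (8 * π * p.1 ^ (q - 3)) * ‖G p.2‖ₑ ^ 2)
      (l, ξ) with hF
  have hFm : AEMeasurable (Function.uncurry F) ((volume.restrict (Set.Ioi 0)).prod volume) := by
    refine AEMeasurable.indicator ?_ (measurableSet_le measurable_fst (hLm.comp measurable_snd))
    exact (by fun_prop : Measurable fun p : ℝ × ℝ =>
      ENNReal.ofReal (8 * π * p.1 ^ (q - 3))).aemeasurable.mul (hG.1.enorm.pow_const 2).comp_snd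
  have hstep : ∫⁻ l in Set.Ioi (0 : ℝ), volume {s | l < ‖FT1 G s‖} * ENNReal.ofReal (l ^ (q - 1))
      ≤ ∫⁻ l in Set.Ioi (0 : ℝ), ∫⁻ ξ, F l ξ := by
    refine setLIntegral_mono' measurableSet_Ioi fun l hl => ?_
    have hl : 0 < l := hl
    refine (mul_le_mul_left (hlevel l hl) _).trans_eq ?_
    rw [mul_right_comm, ← ENNReal.ofReal_mul (by positivity),
      ← lintegral_const_mul' _ _ ENNReal.ofReal_ne_top,
      ← lintegral_indicator (measurableSet_le measurable_const hLm)]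
    refine lintegral_congr fun ξ => ?_
    have he : 8 * π / l ^ 2 * l ^ (q - 1) = 8 * π * l ^ (q - 3) := by
      rw [show q - 1 = (q - 3) + (2 : ℕ) by push_cast; ring, Real.rpow_add_natCast hl.ne']
      field_simp
    rw [he]
    simp only [hF, Set.indicator, Set.mem_ofPred_eq]
  have hinner : ∀ ξ, ∫⁻ l in Set.Ioi (0 : ℝ), F l ξ
      = ENNReal.ofReal (8 * π * (D ^ (q - 2) / (q - 2))) *
        (ENNReal.ofReal (|ξ| ^ (1 - 2 / q)) * ‖G ξ‖ₑ ^ 2) := by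
    intro ξ
    have hL0 : 0 ≤ L ξ := by positivity
    have h1 : ∫⁻ l in Set.Ioi (0 : ℝ), F l ξ
        = ∫⁻ l in Set.Ioc (0 : ℝ) (L ξ),
          ENNReal.ofReal (8 * π) * ENNReal.ofReal (l ^ (q - 3)) * ‖G ξ‖ₑ ^ 2 := by
      rw [← Set.Ioi_inter_Iic, Set.inter_comm, ← Measure.restrict_restrict measurableSet_Iic,
        ← lintegral_indicator measurableSet_Iic]
      refine lintegral_congr fun l => ?_
      simp only [hF, Set.indicator, Set.mem_ofPred_eq, Set.mem_Iic]
      rw [ENNReal.ofReal_mul (by positivity)]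
    rw [h1, lintegral_mul_const' _ _ (by finiteness), lintegral_const_mul' _ _ ENNReal.ofReal_ne_top,
      lintegral_Ioc_rpow (by linarith) hL0, ← mul_assoc, ← ENNReal.ofReal_mul (by positivity),
      ← ENNReal.ofReal_mul (by
        have : 0 < q - 2 := by linarith
        positivity)]
    congr 2
    rw [show q - 3 + 1 = q - 2 by ring, hL, Real.mul_rpow hDpos.le (by positivity),
      ← Real.rpow_mul (abs_nonneg _), show 1 / q * (q - 2) = 1 - 2 / q by field_simp]
    ring
  refine (mul_le_mul_right hstep _).trans_eq ?_
  rw [lintegral_lintegral_swap hFm, lintegral_congr hinner,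
    lintegral_const_mul' _ _ ENNReal.ofReal_ne_top, ← hM, hMm,
    ENNReal.ofReal_rpow_of_nonneg hmpos.le (by positivity), ← mul_assoc,
    ← ENNReal.ofReal_mul hq0.le, ← ENNReal.ofReal_mul (by
        have : 0 < q - 2 := by linarith
        positivity), ← ENNReal.ofReal_mul hK.le]
  congr 1
  have hmq : m ^ (q / 2) = √m ^ (q - 2) * m := by
    rw [Real.sqrt_eq_rpow, ← Real.rpow_mul hmpos.le]
    nth_rewrite 3 [← Real.rpow_one m]
    rw [← Real.rpow_add hmpos]
    congr 1
    ring
  rw [hmq, hD, Real.mul_rpow (by positivity) (by positivity)]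
  ring

end Sobolev

section Minkowski

/-- Minkowski's integral inequality, with the inner norms replaced by an upper bound `B`. -/
theorem lintegral_lintegral_rpow_le {α β : Type*} [MeasurableSpace α] [MeasurableSpace β]
    {μ : Measure α} {ν : Measure β} [SFinite μ] [SFinite ν] {p : ℝ} (hp : 1 < p)
    {f : α → β → ℝ≥0∞} (hf : Measurable (Function.uncurry f)) {B : β → ℝ≥0∞} (hB : Measurable B)
    (h : ∀ᵐ b ∂ν, ∫⁻ a, f a b ^ p ∂μ ≤ B b ^ p) :
    ∫⁻ a, (∫⁻ b, f a b ∂ν) ^ p ∂μ ≤ (∫⁻ b, B b ∂ν) ^ p := by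
  have hp0 : 0 < p := by linarith
  have hp1 : 0 < p - 1 := by linarith
  rcases eq_or_ne (∫⁻ b, B b ∂ν) ∞ with hI | hI
  · rw [hI, ENNReal.top_rpow_of_pos hp0]
    exact le_top
  have hBt : ∀ᵐ b ∂ν, B b < ∞ := ae_lt_top hB hI
  have hfa : ∀ a, Measurable (f a) := fun a => hf.comp measurable_prodMk_left
  have hfb : ∀ b, Measurable fun a => f a b := fun b => hf.comp measurable_prodMk_right
  have hzero : ∀ᵐ b ∂ν, ∀ᵐ a ∂μ, B b = 0 → f a b = 0 := by
    filter_upwards [h] with b hb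
    by_cases hB0 : B b = 0
    · rw [hB0, ENNReal.zero_rpow_of_pos hp0, nonpos_iff_eq_zero,
        lintegral_eq_zero_iff ((hfb b).pow_const p)] at hb
      filter_upwards [hb] with a ha _
      simpa [hp0, hp0.not_gt] using ha
    · exact Filter.Eventually.of_forall fun a h => absurd h hB0
  have hzero' : ∀ᵐ a ∂μ, ∀ᵐ b ∂ν, B b = 0 → f a b = 0 := by
    refine (Measure.ae_ae_comm ?_).1 hzero
    have h1 : MeasurableSet {x : β × α | B x.1 = 0} :=
      (hB.comp measurable_fst) (measurableSet_singleton 0)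
    have h2 : MeasurableSet {x : β × α | f x.2 x.1 = 0} :=
      (hf.comp measurable_swap) (measurableSet_singleton 0)
    exact h1.imp h2
  have hcf : p.HolderConjugate p.conjExponent := Real.HolderConjugate.conjExponent hp
  have hexp : 1 / p.conjExponent * p = p - 1 := by
    rw [Real.conjExponent]
    field_simp
  have hpt : ∀ᵐ a ∂μ, (∫⁻ b, f a b ∂ν) ^ p
      ≤ (∫⁻ b, f a b ^ p * B b ^ (1 - p) ∂ν) * (∫⁻ b, B b ∂ν) ^ (p - 1) := by
    filter_upwards [hzero'] with a ha
    have hsplit : ∫⁻ b, f a b ∂ν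
        = ∫⁻ b, ((fun b => f a b * B b ^ ((1 - p) / p)) * fun b => B b ^ ((p - 1) / p)) b ∂ν := by
      refine lintegral_congr_ae ?_
      filter_upwards [ha, hBt] with b hb hbt
      simp only [Pi.mul_apply]
      by_cases hB0 : B b = 0
      · simp [hb hB0]
      · rw [mul_assoc, ← ENNReal.rpow_add _ _ hB0 hbt.ne,
          show (1 - p) / p + (p - 1) / p = 0 by ring, ENNReal.rpow_zero, mul_one]
    rw [hsplit]
    have hH := ENNReal.lintegral_mul_le_Lp_mul_Lq ν hcf
      (f := fun b => f a b * B b ^ ((1 - p) / p)) (g := fun b => B b ^ ((p - 1) / p))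
      ((hfa a).mul (hB.pow_const _)).aemeasurable (hB.pow_const _).aemeasurable
    refine (ENNReal.rpow_le_rpow hH hp0.le).trans_eq ?_
    rw [ENNReal.mul_rpow_of_nonneg _ _ hp0.le, ← ENNReal.rpow_mul, ← ENNReal.rpow_mul, hexp,
      one_div_mul_cancel hp0.ne', ENNReal.rpow_one]
    congr 1
    · refine lintegral_congr fun b => ?_
      rw [ENNReal.mul_rpow_of_nonneg _ _ hp0.le, ← ENNReal.rpow_mul, div_mul_cancel₀ _ hp0.ne']
    · congr 1
      refine lintegral_congr fun b => ?_
      rw [← ENNReal.rpow_mul, Real.conjExponent, div_mul_div_comm, mul_comm (p - 1) p,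
        div_self (by positivity), ENNReal.rpow_one]
  have hm : Measurable (Function.uncurry fun a b => f a b ^ p * B b ^ (1 - p)) :=
    (hf.pow_const p).mul ((hB.comp measurable_snd).pow_const _)
  calc ∫⁻ a, (∫⁻ b, f a b ∂ν) ^ p ∂μ
      ≤ ∫⁻ a, (∫⁻ b, f a b ^ p * B b ^ (1 - p) ∂ν) * (∫⁻ b, B b ∂ν) ^ (p - 1) ∂μ :=
        lintegral_mono_ae hpt
    _ = (∫⁻ b, ∫⁻ a, f a b ^ p * B b ^ (1 - p) ∂μ ∂ν) * (∫⁻ b, B b ∂ν) ^ (p - 1) := by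
        rw [lintegral_mul_const' _ _ (ENNReal.rpow_ne_top_of_nonneg hp1.le hI),
          lintegral_lintegral_swap hm.aemeasurable]
    _ ≤ (∫⁻ b, B b ∂ν) * (∫⁻ b, B b ∂ν) ^ (p - 1) := by
        refine mul_le_mul_left (lintegral_mono_ae ?_) _
        filter_upwards [h, hBt] with b hb hbt
        rw [lintegral_mul_const _ ((hfb b).pow_const p)]
        refine (mul_le_mul_left hb _).trans ?_
        by_cases hB0 : B b = 0
        · simp [hB0, hp0]
        · rw [← ENNReal.rpow_add _ _ hB0 hbt.ne]
          simp
    _ = (∫⁻ b, B b ∂ν) ^ p := by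
        have : (∫⁻ b, B b ∂ν) ^ p = (∫⁻ b, B b ∂ν) ^ (1 + (p - 1)) := by congr 1; ring
        rw [this, ENNReal.rpow_add_of_nonneg _ _ zero_le_one hp1.le, ENNReal.rpow_one]

end Minkowski

section Core

theorem abs_add_rpow_mul_abs_rpow_le {a b : ℝ} (ha : 0 ≤ a) (hb : 0 ≤ b) (ξ η : ℝ) :
    |ξ + η| ^ (2 * a) * |ξ| ^ (2 * b) ≤ 2 ^ a * (ξ ^ 2 + η ^ 2) ^ (a + b) := by
  have h1 : |ξ + η| ^ (2 * a) ≤ 2 ^ a * (ξ ^ 2 + η ^ 2) ^ a := by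
    rw [Real.rpow_mul (abs_nonneg _), Real.rpow_two, sq_abs, ← Real.mul_rpow (by norm_num)
      (by positivity)]
    exact Real.rpow_le_rpow (by positivity) (by nlinarith [sq_nonneg (ξ - η)]) ha
  have h2 : |ξ| ^ (2 * b) ≤ (ξ ^ 2 + η ^ 2) ^ b := by
    rw [Real.rpow_mul (abs_nonneg _), Real.rpow_two, sq_abs]
    exact Real.rpow_le_rpow (by positivity) (by nlinarith [sq_nonneg η]) hb
  rw [Real.rpow_add_of_nonneg (by positivity) ha hb, ← mul_assoc]
  exact mul_le_mul h1 h2 (by positivity) (by positivity)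

/-- The collapsing estimate on the Fourier side: `Φ` is the Fourier transform of the data, and
the inner transform is, up to a phase and a constant, that of the collapsed density. -/
theorem exists_collapsing_fourier_side {q s : ℝ} (hq : 2 < q) (hs : 1 / q ≤ s) :
    ∃ K : ℝ, 0 < K ∧ ∀ Φ : ℝ → ℝ → ℂ, Continuous (Function.uncurry Φ) →
      (∀ ζ, Integrable fun ξ => Φ ξ (ζ - ξ)) →
      ∫⁻ t : ℝ, (∫⁻ ζ : ℝ, ENNReal.ofReal (|ζ| ^ (2 * s)) *
          ‖FT1 (fun ξ => Φ ξ (ζ - ξ)) (t * (2 * ζ))‖ₑ ^ 2) ^ (q / 2)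
        ≤ ENNReal.ofReal K * (∫⁻ ξ : ℝ, ∫⁻ η : ℝ,
          ENNReal.ofReal ((ξ ^ 2 + η ^ 2) ^ (s - 2 / q + 1 / 2)) * ‖Φ ξ η‖ₑ ^ 2) ^ (q / 2) := by
  obtain ⟨K, hK, hsob⟩ := exists_lintegral_FT1_rpow_le hq
  have hq0 : 0 < q := by linarith
  have hp0 : 0 < q / 2 := by positivity
  set a := s - 1 / q with ha
  have ha0 : 0 ≤ a := by rw [ha]; linarith
  set c : ℝ := (K / 2) ^ (2 / q) with hc
  have hc0 : 0 < c := by positivity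
  refine ⟨(c * 2 ^ a) ^ (q / 2), by positivity, fun Φ hΦ hint => ?_⟩
  set M : ℝ → ℝ≥0∞ := fun ζ =>
    ∫⁻ ξ, ENNReal.ofReal (|ξ| ^ (1 - 2 / q)) * ‖Φ ξ (ζ - ξ)‖ₑ ^ 2 with hM
  have hΦm : Measurable (Function.uncurry Φ) := hΦ.measurable
  have hΦs : Measurable fun p : ℝ × ℝ => Φ p.2 (p.1 - p.2) :=
    hΦm.comp (measurable_snd.prodMk (measurable_fst.sub measurable_snd))
  have hMm' : Measurable fun p : ℝ × ℝ =>
      ENNReal.ofReal (|p.2| ^ (1 - 2 / q)) * ‖Φ p.2 (p.1 - p.2)‖ₑ ^ 2 :=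
    (by fun_prop : Measurable fun p : ℝ × ℝ => ENNReal.ofReal (|p.2| ^ (1 - 2 / q))).mul
      (hΦs.enorm.pow_const 2)
  have hMm : Measurable M := hMm'.lintegral_prod_right'
  set B : ℝ → ℝ≥0∞ := fun ζ => ENNReal.ofReal (c * |ζ| ^ (2 * a)) * M ζ with hB
  have hBm : Measurable B :=
    (by fun_prop : Measurable fun ζ : ℝ => ENNReal.ofReal (c * |ζ| ^ (2 * a))).mul hMm
  have hFTm : Measurable fun p : ℝ × ℝ => FT1 (fun ξ => Φ ξ (p.2 - ξ)) (p.1 * (2 * p.2)) := by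
    have : StronglyMeasurable fun r : (ℝ × ℝ) × ℝ =>
        Complex.exp (-(Complex.I) * ((r.1.1 * (2 * r.1.2) : ℝ) : ℂ) * (r.2 : ℂ)) *
          Φ r.2 (r.1.2 - r.2) := by
      refine Measurable.stronglyMeasurable (Measurable.mul (by fun_prop) ?_)
      exact hΦs.comp ((measurable_snd.comp measurable_fst).prodMk measurable_snd)
    exact this.integral_prod_right'.measurable
  have hfm : Measurable (Function.uncurry fun t ζ : ℝ => ENNReal.ofReal (|ζ| ^ (2 * s)) *
      ‖FT1 (fun ξ => Φ ξ (ζ - ξ)) (t * (2 * ζ))‖ₑ ^ 2) :=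
    (by fun_prop : Measurable fun p : ℝ × ℝ => ENNReal.ofReal (|p.2| ^ (2 * s))).mul
      (hFTm.enorm.pow_const 2)
  have hbound : ∀ᵐ ζ : ℝ, ∫⁻ t : ℝ, (ENNReal.ofReal (|ζ| ^ (2 * s)) *
      ‖FT1 (fun ξ => Φ ξ (ζ - ξ)) (t * (2 * ζ))‖ₑ ^ 2) ^ (q / 2) ≤ B ζ ^ (q / 2) := by
    have hne : ∀ᵐ ζ : ℝ, ζ ≠ 0 := by simp [ae_iff]
    filter_upwards [hne] with ζ hζ
    have hζ0 : 0 < |ζ| := abs_pos.2 hζ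
    have h1 : ∀ t : ℝ, (ENNReal.ofReal (|ζ| ^ (2 * s)) *
        ‖FT1 (fun ξ => Φ ξ (ζ - ξ)) (t * (2 * ζ))‖ₑ ^ 2) ^ (q / 2)
        = ENNReal.ofReal (|ζ| ^ (s * q)) * ‖FT1 (fun ξ => Φ ξ (ζ - ξ)) (t * (2 * ζ))‖ₑ ^ q := by
      intro t
      rw [ENNReal.mul_rpow_of_nonneg _ _ hp0.le, ENNReal.ofReal_rpow_of_nonneg (by positivity)
        hp0.le, ← Real.rpow_mul hζ0.le, ← ENNReal.rpow_natCast, ← ENNReal.rpow_mul]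
      congr 3 <;> push_cast <;> ring
    rw [lintegral_congr h1, lintegral_const_mul' _ _ ENNReal.ofReal_ne_top,
      lintegral_comp_mul_right_real (fun x => ‖FT1 (fun ξ => Φ ξ (ζ - ξ)) x‖ₑ ^ q)
        (mul_ne_zero two_ne_zero hζ)]
    refine (mul_le_mul_right (mul_le_mul_right (hsob _ (hint ζ)) _) _).trans_eq ?_
    rw [hB, ENNReal.mul_rpow_of_nonneg _ _ hp0.le, ENNReal.ofReal_rpow_of_nonneg (by positivity)
        hp0.le, ← mul_assoc, ← mul_assoc, ← ENNReal.ofReal_mul (by positivity),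
        ← ENNReal.ofReal_mul (by positivity)]
    congr 2
    rw [Real.mul_rpow hc0.le (by positivity), hc, ← Real.rpow_mul (by positivity),
      ← Real.rpow_mul hζ0.le, show 2 / q * (q / 2) = 1 by field_simp, Real.rpow_one,
      show 2 * a * (q / 2) = s * q - 1 by rw [ha]; field_simp, Real.rpow_sub_one hζ0.ne',
      abs_mul, abs_two]
    field_simp
  have hmink := lintegral_lintegral_rpow_le (by linarith : 1 < q / 2) hfm hBm hbound
  refine hmink.trans ?_
  rw [← ENNReal.ofReal_rpow_of_nonneg (by positivity) hp0.le,
    ← ENNReal.mul_rpow_of_nonneg _ _ hp0.le]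
  refine ENNReal.rpow_le_rpow ?_ hp0.le
  calc ∫⁻ ζ, B ζ
      = ∫⁻ ζ, ∫⁻ ξ, ENNReal.ofReal (c * |ζ| ^ (2 * a)) *
          (ENNReal.ofReal (|ξ| ^ (1 - 2 / q)) * ‖Φ ξ (ζ - ξ)‖ₑ ^ 2) :=
        lintegral_congr fun ζ => (lintegral_const_mul' _ _ ENNReal.ofReal_ne_top).symm
    _ = ∫⁻ ξ, ∫⁻ ζ, ENNReal.ofReal (c * |ζ| ^ (2 * a)) *
          (ENNReal.ofReal (|ξ| ^ (1 - 2 / q)) * ‖Φ ξ (ζ - ξ)‖ₑ ^ 2) := by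
        refine lintegral_lintegral_swap (Measurable.aemeasurable ?_)
        exact (by fun_prop : Measurable fun p : ℝ × ℝ =>
          ENNReal.ofReal (c * |p.1| ^ (2 * a))).mul hMm'
    _ = ∫⁻ ξ, ∫⁻ η, ENNReal.ofReal (c * |ξ + η| ^ (2 * a)) *
          (ENNReal.ofReal (|ξ| ^ (1 - 2 / q)) * ‖Φ ξ η‖ₑ ^ 2) := by
        refine lintegral_congr fun ξ => ?_
        rw [← lintegral_add_left_eq_self _ ξ]
        simp
    _ ≤ ∫⁻ ξ, ∫⁻ η, ENNReal.ofReal (c * 2 ^ a) *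
          (ENNReal.ofReal ((ξ ^ 2 + η ^ 2) ^ (s - 2 / q + 1 / 2)) * ‖Φ ξ η‖ₑ ^ 2) := by
        refine lintegral_mono fun ξ => lintegral_mono fun η => ?_
        simp only [← mul_assoc]
        rw [← ENNReal.ofReal_mul (by positivity), ← ENNReal.ofReal_mul (by positivity)]
        refine mul_le_mul_left (ENNReal.ofReal_le_ofReal ?_) _
        have hb : (0 : ℝ) ≤ 1 / 2 - 1 / q := by
          rw [sub_nonneg]
          exact one_div_le_one_div_of_le two_pos hq.le
        have := abs_add_rpow_mul_abs_rpow_le ha0 hb ξ η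
        rw [show 2 * (1 / 2 - 1 / q) = 1 - 2 / q by ring,
          show a + (1 / 2 - 1 / q) = s - 2 / q + 1 / 2 by rw [ha]; ring] at this
        rw [mul_assoc, mul_assoc]
        exact mul_le_mul_of_nonneg_left this hc0.le
    _ = _ := by
        rw [← lintegral_const_mul' _ _ ENNReal.ofReal_ne_top]
        exact lintegral_congr fun ξ => lintegral_const_mul' _ _ ENNReal.ofReal_ne_top

end Core

section TwoDim

open FourierTransform

/-- The Fourier transform of a Schwartz kernel is a Schwartz kernel. -/
theorem exists_schwartz_eq_FT2 (f : 𝓢(ℝ × ℝ, ℂ)) :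
    ∃ Ψ : 𝓢(ℝ × ℝ, ℂ), ∀ ξ η, FT2 (fun a b => f (a, b)) ξ η = Ψ (ξ, η) := by
  let e : WithLp 2 (ℝ × ℝ) ≃L[ℝ] ℝ × ℝ := WithLp.prodContinuousLinearEquiv 2 ℝ ℝ ℝ
  let g : 𝓢(WithLp 2 (ℝ × ℝ), ℂ) := compCLMOfContinuousLinearEquiv ℂ e f
  let c : ℝˣ := Units.mk0 (2 * π)⁻¹ (by positivity)
  let e' : (ℝ × ℝ) ≃L[ℝ] WithLp 2 (ℝ × ℝ) :=
    (ContinuousLinearEquiv.unitsEquivAut ℝ c).prodCongr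
      (ContinuousLinearEquiv.unitsEquivAut ℝ c) |>.trans e.symm
  refine ⟨compCLMOfContinuousLinearEquiv ℂ e' (𝓕 g), fun ξ η => ?_⟩
  have he' : e' (ξ, η) = WithLp.toLp 2 (ξ * (2 * π)⁻¹, η * (2 * π)⁻¹) := rfl
  simp only [compCLMOfContinuousLinearEquiv_apply, Function.comp_apply, he']
  rw [SchwartzMap.fourier_coe, Real.fourier_eq', FT2]
  have hmp := WithLp.volume_preserving_toLp ℝ ℝ
  rw [← hmp.integral_comp (MeasurableEquiv.toLp 2 (ℝ × ℝ)).measurableEmbedding]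
  have hker : ∀ p : ℝ × ℝ, Complex.exp (((-2 * π * inner ℝ (WithLp.toLp 2 p)
      (WithLp.toLp 2 (ξ * (2 * π)⁻¹, η * (2 * π)⁻¹)) : ℝ) : ℂ) * Complex.I) • g (WithLp.toLp 2 p)
      = Complex.exp (-(Complex.I) * ((ξ : ℂ) * p.1 + (η : ℂ) * p.2)) * f (p.1, p.2) := by
    intro p
    have hg : g (WithLp.toLp 2 p) = f (p.1, p.2) := rfl
    have hexp : ((-2 * π * inner ℝ (WithLp.toLp 2 p)
        (WithLp.toLp 2 (ξ * (2 * π)⁻¹, η * (2 * π)⁻¹)) : ℝ) : ℂ) * Complex.I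
        = -(Complex.I) * ((ξ : ℂ) * p.1 + (η : ℂ) * p.2) := by
      simp only [WithLp.prod_inner_apply, RCLike.inner_apply, conj_trivial]
      push_cast
      field_simp
    rw [smul_eq_mul, hg, hexp]
  simp only [hker]
  rw [Measure.volume_eq_prod, integral_prod]
  have hfi : Integrable f ((volume : Measure ℝ).prod volume) := f.integrable
  refine hfi.bdd_mul (c := 1) (by fun_prop) (Filter.Eventually.of_forall fun p => ?_)
  rw [show -Complex.I * ((ξ : ℂ) * p.1 + (η : ℂ) * p.2)
    = ((-(ξ * p.1 + η * p.2) : ℝ) : ℂ) * Complex.I by push_cast; ring,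
    Complex.norm_exp_ofReal_mul_I]

theorem rpow_sq_add_sq_le {s : ℝ} (hs : 0 ≤ s) (ξ η : ℝ) :
    (ξ ^ 2 + η ^ 2) ^ (s / 2) ≤ 2 ^ (s / 2) * (1 + ‖(ξ, η)‖) ^ ⌈s⌉₊ := by
  have h1 : |ξ| ≤ ‖(ξ, η)‖ := norm_fst_le (ξ, η)
  have h2 : |η| ≤ ‖(ξ, η)‖ := norm_snd_le (ξ, η)
  have h0 : 0 ≤ ‖(ξ, η)‖ := norm_nonneg _
  have h3 : ξ ^ 2 + η ^ 2 ≤ 2 * (1 + ‖(ξ, η)‖) ^ 2 := by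
    rw [← sq_abs ξ, ← sq_abs η]
    nlinarith [abs_nonneg ξ, abs_nonneg η]
  refine (Real.rpow_le_rpow (by positivity) h3 (by positivity)).trans ?_
  rw [Real.mul_rpow (by norm_num) (by positivity), ← Real.rpow_natCast (_ + _),
    ← Real.rpow_mul (by positivity), ← Real.rpow_natCast (_ + _)]
  refine mul_le_mul_of_nonneg_left (Real.rpow_le_rpow_of_exponent_le (by linarith) ?_)
    (by positivity)
  push_cast
  rw [mul_div_cancel₀ _ two_ne_zero]
  exact Nat.le_ceil s

/-- Schwartz kernels multiplied by `(ξ² + η²)^{s/2}` decay at least like `(1+ξ²)⁻¹(1+η²)⁻¹`. -/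
theorem exists_rpow_mul_schwartz_le (Ψ : 𝓢(ℝ × ℝ, ℂ)) {s : ℝ} (hs : 0 ≤ s) :
    ∃ C : ℝ, ∀ ξ η : ℝ, ‖(((ξ ^ 2 + η ^ 2) ^ (s / 2) : ℝ) : ℂ) * Ψ (ξ, η)‖
      ≤ C * ((1 + ξ ^ 2)⁻¹ * (1 + η ^ 2)⁻¹) := by
  set D := 2 ^ (⌈s⌉₊ + 4) *
    (Finset.Iic (⌈s⌉₊ + 4, 0)).sup (fun m => SchwartzMap.seminorm ℂ m.1 m.2) Ψ
  refine ⟨2 ^ (s / 2) * D, fun ξ η => ?_⟩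
  have hD := one_add_le_sup_seminorm_apply (𝕜 := ℂ) (m := (⌈s⌉₊ + 4, 0)) le_rfl le_rfl Ψ (ξ, η)
  rw [norm_iteratedFDeriv_zero] at hD
  have h1 : |ξ| ≤ ‖(ξ, η)‖ := norm_fst_le (ξ, η)
  have h2 : |η| ≤ ‖(ξ, η)‖ := norm_snd_le (ξ, η)
  have h0 : 0 ≤ ‖(ξ, η)‖ := norm_nonneg _
  have h4 : (1 + ξ ^ 2) * (1 + η ^ 2) ≤ (1 + ‖(ξ, η)‖) ^ 4 := by
    have ha : 1 + ξ ^ 2 ≤ (1 + ‖(ξ, η)‖) ^ 2 := by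
      rw [← sq_abs ξ]; nlinarith [abs_nonneg ξ]
    have hb : 1 + η ^ 2 ≤ (1 + ‖(ξ, η)‖) ^ 2 := by
      rw [← sq_abs η]; nlinarith [abs_nonneg η]
    calc _ ≤ (1 + ‖(ξ, η)‖) ^ 2 * (1 + ‖(ξ, η)‖) ^ 2 := by gcongr
      _ = _ := by ring
  rw [← mul_inv, ← div_eq_mul_inv, le_div_iff₀ (by positivity), norm_mul, Complex.norm_real,
    Real.norm_of_nonneg (by positivity)]
  calc _ ≤ (2 ^ (s / 2) * (1 + ‖(ξ, η)‖) ^ ⌈s⌉₊) * ‖Ψ (ξ, η)‖ * (1 + ‖(ξ, η)‖) ^ 4 := by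
        gcongr
        exact rpow_sq_add_sq_le hs ξ η
    _ = 2 ^ (s / 2) * ((1 + ‖(ξ, η)‖) ^ (⌈s⌉₊ + 4) * ‖Ψ (ξ, η)‖) := by ring
    _ ≤ _ := by gcongr

theorem exists_schwartz_le (Ψ : 𝓢(ℝ × ℝ, ℂ)) :
    ∃ C : ℝ, ∀ ξ η : ℝ, ‖Ψ (ξ, η)‖ ≤ C * ((1 + ξ ^ 2)⁻¹ * (1 + η ^ 2)⁻¹) := by
  simpa using exists_rpow_mul_schwartz_le Ψ le_rfl

theorem inv_one_add_sq_le_one (x : ℝ) : (1 + x ^ 2)⁻¹ ≤ 1 :=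
  inv_le_one_of_one_le₀ (by nlinarith [sq_nonneg x])

theorem integrable_of_norm_le_inv_one_add_sq {f : ℝ → ℂ} (hf : AEStronglyMeasurable f) {C : ℝ}
    (h : ∀ x, ‖f x‖ ≤ C * (1 + x ^ 2)⁻¹) : Integrable f :=
  (integrable_inv_one_add_sq.const_mul C).mono' hf (Filter.Eventually.of_forall h)

theorem memLp_two_of_norm_le_inv_one_add_sq {f : ℝ → ℂ} (hf : AEStronglyMeasurable f) {C : ℝ}
    (h : ∀ x, ‖f x‖ ≤ C * (1 + x ^ 2)⁻¹) : MemLp f 2 := by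
  have hC : 0 ≤ C := by simpa using (norm_nonneg _).trans (h 0)
  rw [memLp_two_iff_integrable_sq_norm hf]
  refine (integrable_inv_one_add_sq.const_mul (C ^ 2)).mono' (hf.norm.pow 2)
    (Filter.Eventually.of_forall fun x => ?_)
  have h1 := inv_one_add_sq_le_one x
  have h0 : 0 ≤ (1 + x ^ 2)⁻¹ := by positivity
  rw [Real.norm_of_nonneg (by positivity)]
  calc ‖f x‖ ^ 2 ≤ (C * (1 + x ^ 2)⁻¹) ^ 2 := by gcongr; exact h x
    _ = C ^ 2 * ((1 + x ^ 2)⁻¹ * (1 + x ^ 2)⁻¹) := by ring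
    _ ≤ C ^ 2 * ((1 + x ^ 2)⁻¹ * 1) := by gcongr
    _ = _ := by ring

theorem IFT2_eq_IFT1_IFT1 (H : ℝ → ℝ → ℂ) (x y : ℝ) :
    IFT2 H x y = IFT1 (fun ξ => IFT1 (H ξ) y) x := by
  simp only [IFT2, IFT1, ← integral_const_mul]
  refine integral_congr_ae (Filter.Eventually.of_forall fun ξ => ?_)
  refine integral_congr_ae (Filter.Eventually.of_forall fun η => ?_)
  simp only
  rw [mul_add, Complex.exp_add]
  ring_nf

theorem norm_IFT1_le (g : ℝ → ℂ) (x : ℝ) : ‖IFT1 g x‖ ≤ (2 * π)⁻¹ * ∫ ξ, ‖g ξ‖ := by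
  rw [IFT1, norm_mul]
  refine mul_le_mul (by simp [abs_of_pos Real.pi_pos])
    ((norm_integral_le_integral_norm _).trans_eq ?_) (norm_nonneg _) (by positivity)
  refine integral_congr_ae (Filter.Eventually.of_forall fun ξ => ?_)
  simp only
  rw [norm_mul, show Complex.I * ξ * x = ((ξ * x : ℝ) : ℂ) * Complex.I by push_cast; ring,
    Complex.norm_exp_ofReal_mul_I, one_mul]

/-- Plancherel's theorem for the two-dimensional inverse transform. -/
theorem L2K_IFT2_sq {H : ℝ → ℝ → ℂ} (hH : Continuous (Function.uncurry H)) {C : ℝ}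
    (hC : ∀ ξ η, ‖H ξ η‖ ≤ C * ((1 + ξ ^ 2)⁻¹ * (1 + η ^ 2)⁻¹)) :
    L2K (IFT2 H) ^ 2 = ENNReal.ofReal ((2 * π)⁻¹ ^ 2) * ∫⁻ ξ, ∫⁻ η, ‖H ξ η‖ₑ ^ 2 := by
  have hslice : ∀ ξ, Continuous (H ξ) := fun ξ => hH.comp (Continuous.prodMk_right ξ)
  have hsl : ∀ ξ x, ‖H ξ x‖ ≤ (C * (1 + ξ ^ 2)⁻¹) * (1 + x ^ 2)⁻¹ := fun ξ x => by
    rw [mul_assoc]; exact hC ξ x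
  have hsm : ∀ ξ, AEStronglyMeasurable (H ξ) volume := fun ξ => (hslice ξ).aestronglyMeasurable
  have hK : StronglyMeasurable fun p : ℝ × ℝ => IFT1 (H p.2) p.1 := by
    have : StronglyMeasurable fun r : (ℝ × ℝ) × ℝ =>
        Complex.exp (Complex.I * (r.2 : ℂ) * (r.1.1 : ℂ)) * H r.1.2 r.2 := by
      have h1 : Continuous fun r : (ℝ × ℝ) × ℝ => H r.1.2 r.2 :=
        hH.comp (g := Function.uncurry H) (f := fun r : (ℝ × ℝ) × ℝ => (r.1.2, r.2))
          ((continuous_snd.comp continuous_fst).prodMk continuous_snd)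
      exact (Continuous.mul (by fun_prop) h1).stronglyMeasurable
    have h2 := this.integral_prod_right' (ν := volume)
    exact h2.const_mul _
  have hI : Measurable fun p : ℝ × ℝ => IFT2 H p.1 p.2 := by
    simp only [IFT2_eq_IFT1_IFT1]
    have : StronglyMeasurable fun r : (ℝ × ℝ) × ℝ =>
        Complex.exp (Complex.I * (r.2 : ℂ) * (r.1.1 : ℂ)) * IFT1 (H r.2) r.1.2 := by
      have h1 : StronglyMeasurable fun r : (ℝ × ℝ) × ℝ => IFT1 (H r.2) r.1.2 :=
        hK.comp_measurable (g := fun r : (ℝ × ℝ) × ℝ => (r.1.2, r.2))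
          ((measurable_snd.comp measurable_fst).prodMk measurable_snd)
      exact StronglyMeasurable.mul (Continuous.stronglyMeasurable (by fun_prop)) h1
    have h2 := this.integral_prod_right' (ν := volume)
    exact (h2.const_mul _).measurable
  have hKb : ∀ y ξ, ‖IFT1 (H ξ) y‖
      ≤ ((2 * π)⁻¹ * (C * ∫ x : ℝ, (1 + x ^ 2)⁻¹)) * (1 + ξ ^ 2)⁻¹ := fun y ξ => by
    refine (norm_IFT1_le _ _).trans ?_
    rw [mul_assoc]
    refine mul_le_mul_of_nonneg_left ?_ (by positivity)
    rw [mul_right_comm, ← integral_const_mul]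
    exact integral_mono (integrable_of_norm_le_inv_one_add_sq (hsm ξ) (hsl ξ)).norm
      (integrable_inv_one_add_sq.const_mul _) (hsl ξ)
  have hKm : ∀ y, AEStronglyMeasurable (fun ξ => IFT1 (H ξ) y) volume := fun y =>
    (hK.comp_measurable measurable_prodMk_left).aestronglyMeasurable
  have hsq : L2K (IFT2 H) ^ 2 = ∫⁻ p : ℝ × ℝ, ‖IFT2 H p.1 p.2‖ₑ ^ 2 := by
    rw [L2K]
    simpa using eLpNorm_nnreal_pow_eq_lintegral
      (f := fun p : ℝ × ℝ => IFT2 H p.1 p.2) (p := 2) (μ := volume) (by simp)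
  rw [hsq, Measure.volume_eq_prod, lintegral_prod_symm' _ (hI.enorm.pow_const 2)]
  simp only [IFT2_eq_IFT1_IFT1]
  have hx : ∀ y, ∫⁻ x, ‖IFT1 (fun ξ => IFT1 (H ξ) y) x‖ₑ ^ 2
      = ENNReal.ofReal (2 * π)⁻¹ * ∫⁻ ξ, ‖IFT1 (H ξ) y‖ₑ ^ 2 := fun y =>
    lintegral_enorm_sq_IFT1 (integrable_of_norm_le_inv_one_add_sq (hKm y) (hKb y))
      (memLp_two_of_norm_le_inv_one_add_sq (hKm y) (hKb y))
  have hy : ∀ ξ, ∫⁻ y, ‖IFT1 (H ξ) y‖ₑ ^ 2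
      = ENNReal.ofReal (2 * π)⁻¹ * ∫⁻ η, ‖H ξ η‖ₑ ^ 2 := fun ξ =>
    lintegral_enorm_sq_IFT1 (integrable_of_norm_le_inv_one_add_sq (hsm ξ) (hsl ξ))
      (memLp_two_of_norm_le_inv_one_add_sq (hsm ξ) (hsl ξ))
  rw [lintegral_congr hx, lintegral_const_mul' _ _ ENNReal.ofReal_ne_top,
    lintegral_lintegral_swap (hK.measurable.enorm.pow_const 2).aemeasurable, lintegral_congr hy,
    lintegral_const_mul' _ _ ENNReal.ofReal_ne_top, ← mul_assoc,
    ← ENNReal.ofReal_mul (by positivity), sq]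

theorem integrable_comp_shear {F : ℝ → ℝ → ℂ} (hF : Integrable (Function.uncurry F)) :
    Integrable (fun p : ℝ × ℝ => F p.1 (p.2 - p.1)) (volume.prod volume) := by
  have hmp := measurePreserving_prod_neg_add (volume : Measure ℝ) (volume : Measure ℝ)
  refine (hmp.integrable_comp_of_integrable hF).congr (Filter.Eventually.of_forall fun p => ?_)
  simp only [Function.comp_apply, Function.uncurry, neg_add_eq_sub]

/-- The collapsed density is the inverse transform of the fibre integrals of `F` over `ξ + η`. -/
theorem IFT2_diag {F : ℝ → ℝ → ℂ} (hF : Integrable (Function.uncurry F)) (x : ℝ) :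
    IFT2 F x x = IFT1 (fun ζ => (2 * (π : ℂ))⁻¹ * ∫ ξ, F ξ (ζ - ξ)) x := by
  have hshear : Integrable (Function.uncurry fun ξ ζ : ℝ =>
      Complex.exp (Complex.I * (ζ : ℂ) * (x : ℂ)) * F ξ (ζ - ξ)) (volume.prod volume) := by
    refine (integrable_comp_shear hF).bdd_mul (c := 1) (by fun_prop)
      (Filter.Eventually.of_forall fun p => ?_)
    rw [show Complex.I * (p.2 : ℂ) * x = ((p.2 * x : ℝ) : ℂ) * Complex.I by push_cast; ring,
      Complex.norm_exp_ofReal_mul_I]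
  have hsub : ∀ ξ : ℝ, ∫ η : ℝ, Complex.exp (Complex.I * ((ξ : ℂ) * x + (η : ℂ) * x)) * F ξ η
      = ∫ ζ : ℝ, Complex.exp (Complex.I * (ζ : ℂ) * (x : ℂ)) * F ξ (ζ - ξ) := fun ξ => by
    rw [← integral_sub_right_eq_self _ ξ]
    refine integral_congr_ae (Filter.Eventually.of_forall fun ζ => ?_)
    simp only
    congr 2
    push_cast
    ring
  rw [IFT2, IFT1]
  simp only [hsub]
  rw [integral_integral_swap hshear, sq, mul_inv, mul_assoc, ← integral_const_mul]
  congr 2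
  ext ζ
  rw [integral_const_mul]
  ring

/-- Fourier inversion for the unnormalised transforms. -/
theorem FT1_IFT1 {g : ℝ → ℂ} (hc : Continuous g) (hg : Integrable g)
    (hi : Integrable (IFT1 g)) (ζ : ℝ) : FT1 (IFT1 g) ζ = g ζ := by
  have hpi : (2 * π) ≠ 0 := by positivity
  have hpi' : (2 * (π : ℂ)) ≠ 0 := by exact_mod_cast hpi
  have hinv : ∀ y, 𝓕⁻ g y = (2 * (π : ℂ)) * IFT1 g (y * (2 * π)) := fun y => by
    rw [IFT1_eq_fourierInv, mul_div_cancel_right₀ _ hpi, mul_inv_cancel_left₀ hpi']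
  have hi1 : Integrable (𝓕⁻ g) := by
    rw [show 𝓕⁻ g = fun y => (2 * (π : ℂ)) * IFT1 g (y * (2 * π)) from funext hinv]
    exact (hi.comp_mul_right' hpi).const_mul _
  have hi2 : Integrable (𝓕 g) := by
    have : 𝓕 g = fun y => 𝓕⁻ g (-y) := by
      ext y
      rw [Real.fourierInv_eq_fourier_neg, neg_neg]
    rw [this]
    exact hi1.comp_neg
  rw [← congrFun (hc.fourier_fourierInv_eq hg hi2) ζ, Real.fourier_real_eq_integral_exp_smul, FT1]
  have hsub := Measure.integral_comp_mul_right
    (fun x : ℝ => Complex.exp (-(Complex.I) * (ζ : ℂ) * (x : ℂ)) * IFT1 g x) (2 * π)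
  rw [abs_of_pos (by positivity), eq_inv_smul_iff₀ hpi, ← integral_smul] at hsub
  rw [← hsub]
  refine integral_congr_ae (Filter.Eventually.of_forall fun x => ?_)
  simp only [hinv, smul_eq_mul, Complex.real_smul]
  rw [show -Complex.I * (ζ : ℂ) * ((x * (2 * π) : ℝ) : ℂ)
    = ((-2 * π * x * ζ : ℝ) : ℂ) * Complex.I by push_cast; ring]
  push_cast
  ring

end TwoDim

section Density

theorem norm_exp_phase (t ξ η : ℝ) :
    ‖Complex.exp (Complex.I * (t : ℂ) * ((η : ℂ) ^ 2 - (ξ : ℂ) ^ 2))‖ = 1 := by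
  rw [show Complex.I * (t : ℂ) * ((η : ℂ) ^ 2 - (ξ : ℂ) ^ 2)
    = ((t * (η ^ 2 - ξ ^ 2) : ℝ) : ℂ) * Complex.I by push_cast; ring,
    Complex.norm_exp_ofReal_mul_I]

/-- The spatial Fourier transform of the collapsed density of the evolution with Fourier-side
data `Φ`. -/
def densityFT (Φ : ℝ → ℝ → ℂ) (t ζ : ℝ) : ℂ :=
  (2 * (π : ℂ))⁻¹ * ∫ ξ : ℝ,
    Complex.exp (Complex.I * (t : ℂ) * (((ζ - ξ : ℝ) : ℂ) ^ 2 - (ξ : ℂ) ^ 2)) * Φ ξ (ζ - ξ)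

theorem densityFT_eq_FT1 (Φ : ℝ → ℝ → ℂ) (t ζ : ℝ) :
    densityFT Φ t ζ = (2 * (π : ℂ))⁻¹ * (Complex.exp (((t * ζ ^ 2 : ℝ) : ℂ) * Complex.I) *
      FT1 (fun ξ => Φ ξ (ζ - ξ)) (t * (2 * ζ))) := by
  rw [densityFT, FT1]
  congr 1
  rw [← integral_const_mul]
  refine integral_congr_ae (Filter.Eventually.of_forall fun ξ => ?_)
  simp only
  rw [← mul_assoc, ← Complex.exp_add]
  congr 2
  push_cast
  ring

theorem enorm_densityFT (Φ : ℝ → ℝ → ℂ) (t ζ : ℝ) :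
    ‖densityFT Φ t ζ‖ₑ
      = ENNReal.ofReal (2 * π)⁻¹ * ‖FT1 (fun ξ => Φ ξ (ζ - ξ)) (t * (2 * ζ))‖ₑ := by
  rw [densityFT_eq_FT1, enorm_mul, enorm_mul, ← ofReal_norm (Complex.exp _),
    Complex.norm_exp_ofReal_mul_I, ENNReal.ofReal_one, one_mul, ← ofReal_norm (_⁻¹)]
  congr 2
  simp [abs_of_pos Real.pi_pos]

variable (Ψ : 𝓢(ℝ × ℝ, ℂ))

theorem integrable_fibre (ζ : ℝ) : Integrable fun ξ : ℝ => Ψ (ξ, ζ - ξ) := by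
  obtain ⟨C, hC⟩ := exists_schwartz_le Ψ
  have hC0 : 0 ≤ C := by simpa using (norm_nonneg _).trans (hC 0 0)
  refine integrable_of_norm_le_inv_one_add_sq (C := C)
    (Ψ.continuous.comp (by fun_prop : Continuous fun ξ : ℝ => (ξ, ζ - ξ))).aestronglyMeasurable
    fun ξ => (hC ξ (ζ - ξ)).trans ?_
  exact mul_le_mul_of_nonneg_left
    (mul_le_of_le_one_right (by positivity) (inv_one_add_sq_le_one _)) hC0

theorem continuous_densityFT (t : ℝ) : Continuous (densityFT (fun ξ η => Ψ (ξ, η)) t) := by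
  obtain ⟨C, hC⟩ := exists_schwartz_le Ψ
  have hC0 : 0 ≤ C := by simpa using (norm_nonneg _).trans (hC 0 0)
  have hint : Continuous fun ζ : ℝ => ∫ ξ : ℝ,
      Complex.exp (Complex.I * (t : ℂ) * (((ζ - ξ : ℝ) : ℂ) ^ 2 - (ξ : ℂ) ^ 2)) *
        Ψ (ξ, ζ - ξ) := by
    refine continuous_of_dominated (bound := fun ξ => C * (1 + ξ ^ 2)⁻¹)
      (fun ζ => ?_) (fun ζ => Filter.Eventually.of_forall fun ξ => ?_)
      (integrable_inv_one_add_sq.const_mul C) (Filter.Eventually.of_forall fun ξ => ?_)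
    · exact (Continuous.mul (by fun_prop) (Ψ.continuous.comp
        (by fun_prop : Continuous fun ξ : ℝ => (ξ, ζ - ξ)))).aestronglyMeasurable
    · rw [norm_mul, norm_exp_phase, one_mul]
      exact (hC ξ (ζ - ξ)).trans (mul_le_mul_of_nonneg_left
        (mul_le_of_le_one_right (by positivity) (inv_one_add_sq_le_one _)) hC0)
    · exact Continuous.mul (by fun_prop) (Ψ.continuous.comp
        (by fun_prop : Continuous fun ζ : ℝ => (ξ, ζ - ξ)))
  exact hint.const_mul _

theorem integrable_evolution (t : ℝ) : Integrable (Function.uncurry fun ξ η : ℝ =>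
    Complex.exp (Complex.I * (t : ℂ) * ((η : ℂ) ^ 2 - (ξ : ℂ) ^ 2)) * Ψ (ξ, η)) := by
  have hΨ : Integrable Ψ := Ψ.integrable
  refine hΨ.bdd_mul (c := 1) (f := fun p : ℝ × ℝ =>
    Complex.exp (Complex.I * (t : ℂ) * ((p.2 : ℂ) ^ 2 - (p.1 : ℂ) ^ 2)))
    (by fun_prop) (Filter.Eventually.of_forall fun p => ?_)
  rw [norm_exp_phase]

theorem integrable_densityFT (t : ℝ) : Integrable (densityFT (fun ξ η => Ψ (ξ, η)) t) :=
  (integrable_comp_shear (integrable_evolution Ψ t)).integral_prod_right.const_mul _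

theorem enorm_FT1_IFT1_le {g : ℝ → ℂ} (hc : Continuous g) (hg : Integrable g) (ζ : ℝ) :
    ‖FT1 (IFT1 g) ζ‖ₑ ≤ ‖g ζ‖ₑ := by
  by_cases hi : Integrable (IFT1 g)
  · rw [FT1_IFT1 hc hg hi]
  · simp [FT1_eq_zero_of_not_integrable hi]

theorem freeGamma_diag {f : ℝ → ℝ → ℂ} (hf : ∀ ξ η, FT2 f ξ η = Ψ (ξ, η)) (t : ℝ) :
    (fun a => freeGamma f t a a) = IFT1 (densityFT (fun ξ η => Ψ (ξ, η)) t) := by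
  ext a
  simp only [freeGamma, hf]
  exact IFT2_diag (integrable_evolution Ψ t) a

theorem lintegral_absDx_freeGamma_le {f : ℝ → ℝ → ℂ} (hf : ∀ ξ η, FT2 f ξ η = Ψ (ξ, η))
    (s t : ℝ) :
    ∫⁻ x, ‖absDx s (fun a => freeGamma f t a a) x‖ₑ ^ 2
      ≤ ENNReal.ofReal ((2 * π)⁻¹ ^ 3) * ∫⁻ ζ : ℝ, ENNReal.ofReal (|ζ| ^ (2 * s)) *
          ‖FT1 (fun ξ => Ψ (ξ, ζ - ξ)) (t * (2 * ζ))‖ₑ ^ 2 := by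
  rw [freeGamma_diag Ψ hf]
  refine (lintegral_enorm_sq_IFT1_le _).trans ?_
  rw [pow_succ' _ 2, ENNReal.ofReal_mul (by positivity), mul_assoc,
    ← lintegral_const_mul' (ENNReal.ofReal ((2 * π)⁻¹ ^ 2)) _ ENNReal.ofReal_ne_top]
  refine mul_le_mul_right (lintegral_mono fun ζ => ?_) _
  have h := enorm_FT1_IFT1_le (continuous_densityFT Ψ t) (integrable_densityFT Ψ t) ζ
  rw [enorm_densityFT] at h
  have hw : ‖((|ζ| ^ s : ℝ) : ℂ)‖ₑ ^ 2 = ENNReal.ofReal (|ζ| ^ (2 * s)) := by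
    rw [← ofReal_norm, Complex.norm_real, Real.norm_of_nonneg (by positivity),
      ← ENNReal.ofReal_pow (by positivity), ← Real.rpow_natCast, ← Real.rpow_mul (abs_nonneg _),
      Nat.cast_ofNat, mul_comm s]
  rw [enorm_mul, mul_pow, hw, mul_left_comm, ENNReal.ofReal_pow (by positivity), ← mul_pow]
  gcongr

theorem lintegral_weight_eq {f : ℝ → ℝ → ℂ} (hf : ∀ ξ η, FT2 f ξ η = Ψ (ξ, η)) {α : ℝ}
    (hα : 0 ≤ α) :
    L2K (absDxy α f) ^ 2 = ENNReal.ofReal ((2 * π)⁻¹ ^ 2) *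
      ∫⁻ ξ : ℝ, ∫⁻ η : ℝ, ENNReal.ofReal ((ξ ^ 2 + η ^ 2) ^ α) * ‖Ψ (ξ, η)‖ₑ ^ 2 := by
  obtain ⟨C, hC⟩ := exists_rpow_mul_schwartz_le Ψ hα
  have hcont : Continuous (Function.uncurry fun ξ η : ℝ =>
      (((ξ ^ 2 + η ^ 2) ^ (α / 2) : ℝ) : ℂ) * Ψ (ξ, η)) := by
    refine Continuous.mul (Complex.continuous_ofReal.comp ?_) Ψ.continuous
    exact (by fun_prop : Continuous fun p : ℝ × ℝ => p.1 ^ 2 + p.2 ^ 2).rpow_const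
      fun _ => Or.inr (by positivity)
  have h := L2K_IFT2_sq hcont hC
  have hdef : absDxy α f = IFT2 fun ξ η : ℝ =>
      (((ξ ^ 2 + η ^ 2) ^ (α / 2) : ℝ) : ℂ) * Ψ (ξ, η) := by
    ext x y
    simp only [absDxy, hf]
  rw [hdef, h]
  refine congrArg _ (lintegral_congr fun ξ => lintegral_congr fun η => ?_)
  rw [enorm_mul, mul_pow, ← ofReal_norm ((_ : ℝ) : ℂ), Complex.norm_real,
    Real.norm_of_nonneg (by positivity), ← ENNReal.ofReal_pow (by positivity),
    ← Real.rpow_natCast, ← Real.rpow_mul (by positivity), Nat.cast_ofNat,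
    div_mul_cancel₀ _ two_ne_zero]

end Density

theorem MixedN2_two_le {q : ℝ} (hq : 0 < q) (μ : Measure ℝ) (u : ℝ → ℝ → ℂ) :
    MixedN2 μ (ENNReal.ofReal q) 2 u
      ≤ (∫⁻ t, (∫⁻ x, ‖u t x‖ₑ ^ 2) ^ (q / 2) ∂μ) ^ (1 / q) := by
  rw [MixedN2, eLpNorm_eq_lintegral_rpow_enorm_toReal (by simpa using hq) ENNReal.ofReal_ne_top,
    ENNReal.toReal_ofReal hq.le]
  refine ENNReal.rpow_le_rpow (lintegral_mono fun t => ?_) (by positivity)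
  have h2 : eLpNorm (u t) 2 volume ^ 2 = ∫⁻ x, ‖u t x‖ₑ ^ 2 := by
    simpa using eLpNorm_nnreal_pow_eq_lintegral (f := u t) (p := 2) (μ := volume) (by simp)
  rw [← h2, ← ENNReal.rpow_natCast, ← ENNReal.rpow_mul, Nat.cast_ofNat,
    mul_div_cancel₀ _ two_ne_zero]
  refine ENNReal.rpow_le_rpow ?_ hq.le
  rw [Real.enorm_of_nonneg ENNReal.toReal_nonneg]
  exact ENNReal.ofReal_toReal_le

/-- The collapsing estimate at the scaling-critical exponents. -/
theorem exists_collapsing_estimate {q s α : ℝ} (hq : 2 < q) (hs : 1 / q ≤ s)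
    (hα : α = s - 2 / q + 1 / 2) :
    ∃ C : ℝ, 0 < C ∧ ∀ Γ₀ : 𝓢(ℝ × ℝ, ℂ),
      MixedN2 volume (ENNReal.ofReal q) 2
          (fun t x => absDx s (fun a => freeGamma (fun a b => Γ₀ (a, b)) t a a) x)
        ≤ ENNReal.ofReal C * L2K (absDxy α (fun a b => Γ₀ (a, b))) := by
  have hq0 : 0 < q := by linarith
  have hα0 : 0 ≤ α := by
    have : 1 / q ≤ 1 / 2 := one_div_le_one_div_of_le (by norm_num) hq.le
    have h2 : 2 / q = 2 * (1 / q) := by ring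
    rw [hα, h2]; linarith
  obtain ⟨K, hK, hcore⟩ := exists_collapsing_fourier_side hq hs
  have hq1 : q / 2 * (1 / q) = 1 / 2 := by field_simp
  set c := (2 * π)⁻¹ ^ 3 with hc
  have hc0 : 0 < c := by positivity
  refine ⟨c ^ (1 / 2 : ℝ) * K ^ (1 / q) * (2 * π), by positivity, fun Γ₀ => ?_⟩
  obtain ⟨Ψ, hΨ⟩ := exists_schwartz_eq_FT2 Γ₀
  have hcoreΨ := hcore (fun ξ η => Ψ (ξ, η)) Ψ.continuous (integrable_fibre Ψ)
  rw [← hα] at hcoreΨ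
  set X := ∫⁻ ξ : ℝ, ∫⁻ η : ℝ, ENNReal.ofReal ((ξ ^ 2 + η ^ 2) ^ α) * ‖Ψ (ξ, η)‖ₑ ^ 2 with hX
  have hXL : X ^ (1 / 2 : ℝ) = ENNReal.ofReal (2 * π) * L2K (absDxy α fun a b => Γ₀ (a, b)) := by
    have h := lintegral_weight_eq Ψ hΨ hα0
    have hXsq : X = (ENNReal.ofReal (2 * π) * L2K (absDxy α fun a b => Γ₀ (a, b))) ^ 2 := by
      rw [mul_pow, h, ← mul_assoc, ← ENNReal.ofReal_pow (by positivity),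
        ← ENNReal.ofReal_mul (by positivity), ← mul_pow, mul_inv_cancel₀ (by positivity),
        one_pow, ENNReal.ofReal_one, one_mul]
    rw [hXsq, ← ENNReal.rpow_natCast, ← ENNReal.rpow_mul]
    norm_num
  calc _ ≤ _ := MixedN2_two_le hq0 _ _
    _ ≤ (∫⁻ t : ℝ, (ENNReal.ofReal c * ∫⁻ ζ : ℝ, ENNReal.ofReal (|ζ| ^ (2 * s)) *
          ‖FT1 (fun ξ => Ψ (ξ, ζ - ξ)) (t * (2 * ζ))‖ₑ ^ 2) ^ (q / 2)) ^ (1 / q) := by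
        gcongr with t
        exact lintegral_absDx_freeGamma_le Ψ hΨ s t
    _ ≤ (ENNReal.ofReal c ^ (q / 2) * (ENNReal.ofReal K * X ^ (q / 2))) ^ (1 / q) := by
        simp only [ENNReal.mul_rpow_of_nonneg _ _ (by positivity : 0 ≤ q / 2)]
        rw [lintegral_const_mul' _ _
          (ENNReal.rpow_ne_top_of_nonneg (by positivity) ENNReal.ofReal_ne_top)]
        gcongr
    _ = ENNReal.ofReal (c ^ (1 / 2 : ℝ)) * (ENNReal.ofReal (K ^ (1 / q)) * X ^ (1 / 2 : ℝ)) := by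
        rw [ENNReal.mul_rpow_of_nonneg _ _ (by positivity),
          ENNReal.mul_rpow_of_nonneg _ _ (by positivity), ← ENNReal.rpow_mul, ← ENNReal.rpow_mul,
          hq1, ENNReal.ofReal_rpow_of_pos hc0, ENNReal.ofReal_rpow_of_pos hK]
    _ = _ := by
        rw [hXL, ENNReal.ofReal_mul (by positivity : 0 ≤ c ^ (1 / 2 : ℝ) * K ^ (1 / q)),
          ENNReal.ofReal_mul (by positivity : 0 ≤ c ^ (1 / 2 : ℝ))]
        simp only [mul_assoc]

/-- Interpolated collapsing estimate. -/
theorem interpolated_collapsing_estimate (ε ε' : ℝ)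
    (hε0 : 0 < ε) (hε : ε < 1/2) (hε'0 : 0 < ε') (hε' : ε' < 1/2 - ε) :
    ∃ C : ℝ, 0 < C ∧ ∀ Γ₀ : 𝓢(ℝ × ℝ, ℂ),
      MixedN2 volume (ENNReal.ofReal ((1 - 2 * ε) / (1/2 - ε' - ε))) 2
          (fun t x => absDx (1/2 - ε') (fun a => freeGamma (fun a b => Γ₀ (a, b)) t a a) x)
        ≤ ENNReal.ofReal C *
            L2K (absDxy (((1/2 + ε) / (1/2 - ε)) * ε') (fun a b => Γ₀ (a, b))) := by
  have h1 : 0 < 1 / 2 - ε' - ε := by linarith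
  have h2 : 0 < 1 - 2 * ε := by linarith
  have h3 : 0 < 1 / 2 - ε := by linarith
  refine exists_collapsing_estimate ?_ ?_ ?_
  · rw [lt_div_iff₀ h1]
    linarith
  · rw [one_div_div, div_le_iff₀ h2]
    nlinarith [mul_pos hε0 hε'0]
  · rw [div_div_eq_mul_div, show 1 - 2 * ε = 2 * (1 / 2 - ε) by ring]
    field_simp
    ring

end
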